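/- arXiv:0710.2169 — 3 statements merged into one kernel-verified Lean document; each statement's English description precedes it below -/
import Mathlib

section
/- Let φ̃'_T : G → E be another group homomorphism with q ∘ φ̃'_T = φ_T, and define σ'(a)(u) := φ̃'_T(u)^{-1} φ̃_Γ(a)^{-1} φ̃'_T(ρ(a)(u)) φ̃_Γ(a). Then the map τ : G → E defined by τ(u) := φ̃_T(u)^{-1} φ̃'_T(u) takes values in A, satisfies the cocycle condition τ(u_1 u_2) = τ(u_2) · (φ̃_T(u_2)^{-1} τ(u_1) φ̃_T(u_2)) for all u_1, u_2 ∈ G, and σ and σ' differ by the coboundary of τ: σ'(a)(u) = σ(a)(u) · τ(u)^{-1} · (φ̃_Γ(a)^{-1} τ(ρ(a)(u)) φ̃_Γ(a)) for all a ∈ Γ, u ∈ G. In particular the cohomology class of σ does not depend on the choice of the lifting φ̃_T of φ_T. -/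
section LiftingObstruction

variable {H E G Γ : Type*} [Group H] [Group E] [Group G] [Group Γ]

/-- The one-cochain `σ(a)(u) := φ̃_T(u)⁻¹ φ̃_Γ(a)⁻¹ φ̃_T(ρ(a)(u)) φ̃_Γ(a)`. -/
def liftingCocycle (ρ : Γ →* MulAut G) (φtT : G →* E) (φtΓ : Γ →* E) (a : Γ) (u : G) : E :=
  (φtT u)⁻¹ * (φtΓ a)⁻¹ * φtT (ρ a u) * φtΓ a

theorem liftingCocycle_mem_ker {q : E →* H} {ρ : Γ →* MulAut G} {φT : G →* H} {φΓ : Γ →* H}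
    (hcompat : ∀ u a, φT (ρ a u) * φΓ a = φΓ a * φT u)
    {φtT : G →* E} {φtΓ : Γ →* E}
    (hqT : ∀ u, q (φtT u) = φT u) (hqΓ : ∀ a, q (φtΓ a) = φΓ a) (a : Γ) (u : G) :
    liftingCocycle ρ φtT φtΓ a u ∈ q.ker := by
  simp only [liftingCocycle, MonoidHom.mem_ker, map_mul, map_inv, hqT, hqΓ]
  rw [mul_assoc, hcompat]
  group

/-- Let `φ̃'_T : G →* E` be another lift of `φ_T` through `q`, with
associated cochain `σ'`.  Then `τ(u) := φ̃_T(u)⁻¹ φ̃'_T(u)` takes values in `A = ker q`,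
satisfies the cocycle condition `τ(u₁u₂) = τ(u₂) * (φ̃_T(u₂)⁻¹ τ(u₁) φ̃_T(u₂))`, and
`σ` and `σ'` differ by the coboundary of `τ`:
`σ'(a)(u) = σ(a)(u) * τ(u)⁻¹ * (φ̃_Γ(a)⁻¹ τ(ρ(a)(u)) φ̃_Γ(a))`.
(In particular the cohomology class of `σ` does not depend on the choice of lift.) -/
theorem liftingCocycle_class_independent_of_lift (q : E →* H)
    (hA : ∀ x ∈ q.ker, ∀ y ∈ q.ker, x * y = y * x)
    (ρ : Γ →* MulAut G) (φT : G →* H) (φΓ : Γ →* H)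
    (hcompat : ∀ u a, φT (ρ a u) * φΓ a = φΓ a * φT u)
    (φtT : G →* E) (φtΓ : Γ →* E)
    (hqT : ∀ u, q (φtT u) = φT u) (hqΓ : ∀ a, q (φtΓ a) = φΓ a)
    (φtT' : G →* E) (hqT' : ∀ u, q (φtT' u) = φT u) :
    (∀ u : G, (φtT u)⁻¹ * φtT' u ∈ q.ker) ∧
    (∀ u₁ u₂ : G,
      (φtT (u₁ * u₂))⁻¹ * φtT' (u₁ * u₂) =
        ((φtT u₂)⁻¹ * φtT' u₂) *
          ((φtT u₂)⁻¹ * ((φtT u₁)⁻¹ * φtT' u₁) * φtT u₂)) ∧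
    (∀ (a : Γ) (u : G),
      liftingCocycle ρ φtT' φtΓ a u =
        liftingCocycle ρ φtT φtΓ a u * ((φtT u)⁻¹ * φtT' u)⁻¹ *
          ((φtΓ a)⁻¹ * ((φtT (ρ a u))⁻¹ * φtT' (ρ a u)) * φtΓ a)) := by
  have hτ (u : G) : (φtT u)⁻¹ * φtT' u ∈ q.ker := by simp [MonoidHom.mem_ker, hqT, hqT']
  refine ⟨hτ, fun u₁ u₂ => ?_, fun a u => ?_⟩
  · have hd : φtT' u₂ * (φtT u₂)⁻¹ ∈ q.ker := by simp [MonoidHom.mem_ker, hqT, hqT']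
    calc (φtT (u₁ * u₂))⁻¹ * φtT' (u₁ * u₂)
        = (φtT u₂)⁻¹ * (((φtT u₁)⁻¹ * φtT' u₁) * (φtT' u₂ * (φtT u₂)⁻¹)) * φtT u₂ := by
          simp only [map_mul]; group
      _ = _ := by rw [hA _ (hτ u₁) _ hd]; group
  · rw [hA _ (liftingCocycle_mem_ker hcompat hqT hqΓ a u) _ (inv_mem (hτ u))]
    simp only [liftingCocycle]
    group

end LiftingObstruction
end

section
/- There exists a group homomorphism φ̃'_T : G → E with q ∘ φ̃'_T = φ_T and φ̃'_T(ρ(a)(u)) φ̃_Γ(a) = φ̃_Γ(a) φ̃'_T(u) for all u ∈ G and a ∈ Γ, if and only if there exists a map τ : G → A satisfying both: (i) τ(u_1 u_2) = τ(u_2) · (φ̃_T(u_2)^{-1} τ(u_1) φ̃_T(u_2)) for all u_1, u_2 ∈ G, and (ii) σ(a)(u) = τ(u) · (φ̃_Γ(a)^{-1} τ(ρ(a)(u)) φ̃_Γ(a))^{-1} for all a ∈ Γ, u ∈ G. -/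
section LiftingObstruction

variable {H E G Γ : Type*} [Group H] [Group E] [Group G] [Group Γ]

/-- The pointwise product `φ̃_T * τ` is equivariant iff `τ` trivialises the cocycle `σ`. -/
theorem liftingCocycle_eq_iff (ρ : Γ →* MulAut G) (φtT : G →* E) (φtΓ : Γ →* E) (τ : G → E)
    (a : Γ) (u : G) :
    liftingCocycle ρ φtT φtΓ a u = τ u * ((φtΓ a)⁻¹ * τ (ρ a u) * φtΓ a)⁻¹ ↔
      φtT (ρ a u) * τ (ρ a u) * φtΓ a = φtΓ a * (φtT u * τ u) := by
  rw [liftingCocycle, eq_mul_inv_iff_mul_eq, ← mul_assoc (φtΓ a), ← inv_mul_eq_iff_eq_mul]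
  simp only [mul_inv_rev, mul_assoc, mul_inv_cancel_left]

/-- For `τ` with values in a commutative kernel, `φ̃_T * τ` is multiplicative iff `τ` is a
crossed homomorphism. -/
theorem crossedHom_iff_mul_lift (q : E →* H)
    (hA : ∀ x ∈ q.ker, ∀ y ∈ q.ker, x * y = y * x) (φtT : G →* E) (τ : G → E)
    (hτ : ∀ u, τ u ∈ q.ker) (u₁ u₂ : G) :
    τ (u₁ * u₂) = τ u₂ * ((φtT u₂)⁻¹ * τ u₁ * φtT u₂) ↔
      φtT (u₁ * u₂) * τ (u₁ * u₂) = φtT u₁ * τ u₁ * (φtT u₂ * τ u₂) := by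
  have hconj : (φtT u₂)⁻¹ * τ u₁ * φtT u₂ ∈ q.ker := by
    simpa using q.normal_ker.conj_mem _ (hτ u₁) (φtT u₂)⁻¹
  rw [hA _ (hτ u₂) _ hconj, ← mul_right_inj (φtT (u₁ * u₂)), map_mul]
  simp only [mul_assoc, mul_inv_cancel_left]

/-- There exists a group homomorphism `φ̃'_T : G →* E` with
`q ∘ φ̃'_T = φ_T` and `φ̃'_T(ρ(a)(u)) φ̃_Γ(a) = φ̃_Γ(a) φ̃'_T(u)` for all `u, a`,
if and only if there exists a map `τ : G → A = ker q` satisfying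
(i) `τ(u₁u₂) = τ(u₂) * (φ̃_T(u₂)⁻¹ τ(u₁) φ̃_T(u₂))` and
(ii) `σ(a)(u) = τ(u) * (φ̃_Γ(a)⁻¹ τ(ρ(a)(u)) φ̃_Γ(a))⁻¹`. -/
theorem exists_equivariant_lift_iff (q : E →* H)
    (hA : ∀ x ∈ q.ker, ∀ y ∈ q.ker, x * y = y * x)
    (ρ : Γ →* MulAut G) (φT : G →* H) (φΓ : Γ →* H)
    (hcompat : ∀ u a, φT (ρ a u) * φΓ a = φΓ a * φT u)
    (φtT : G →* E) (φtΓ : Γ →* E)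
    (hqT : ∀ u, q (φtT u) = φT u) (hqΓ : ∀ a, q (φtΓ a) = φΓ a) :
    (∃ φtT' : G →* E, (∀ u, q (φtT' u) = φT u) ∧
        ∀ (u : G) (a : Γ), φtT' (ρ a u) * φtΓ a = φtΓ a * φtT' u) ↔
    (∃ τ : G → E, (∀ u, τ u ∈ q.ker) ∧
        (∀ u₁ u₂ : G, τ (u₁ * u₂) = τ u₂ * ((φtT u₂)⁻¹ * τ u₁ * φtT u₂)) ∧
        (∀ (a : Γ) (u : G),
          liftingCocycle ρ φtT φtΓ a u =
            τ u * ((φtΓ a)⁻¹ * τ (ρ a u) * φtΓ a)⁻¹)) := by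
  constructor
  · rintro ⟨φtT', hq, heq⟩
    have hτ : ∀ u, (φtT u)⁻¹ * φtT' u ∈ q.ker := fun u => by
      rw [MonoidHom.mem_ker, map_mul, map_inv, hqT, hq, inv_mul_cancel]
    refine ⟨fun u => (φtT u)⁻¹ * φtT' u, hτ, fun u₁ u₂ => ?_, fun a u => ?_⟩
    · apply (crossedHom_iff_mul_lift q hA φtT _ hτ u₁ u₂).2
      simp only [mul_inv_cancel_left, map_mul φtT']
    · apply (liftingCocycle_eq_iff ρ φtT φtΓ (fun u => (φtT u)⁻¹ * φtT' u) a u).2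
      simp only [mul_inv_cancel_left, heq]
  · rintro ⟨τ, hτ, hmul, hσ⟩
    refine ⟨MonoidHom.mk' (fun u => φtT u * τ u) fun u₁ u₂ =>
      (crossedHom_iff_mul_lift q hA φtT τ hτ u₁ u₂).1 (hmul u₁ u₂), fun u => ?_, fun u a =>
      (liftingCocycle_eq_iff ρ φtT φtΓ τ a u).1 (hσ a u)⟩
    rw [MonoidHom.mk'_apply, map_mul, hqT, MonoidHom.mem_ker.1 (hτ u), mul_one]

end LiftingObstruction
end

section
/- Suppose τ : G → A satisfies (i) τ(u_1 u_2) = τ(u_2) · (φ̃_T(u_2)^{-1} τ(u_1) φ̃_T(u_2)) for all u_1, u_2 ∈ G, and (ii) σ(a)(u) = τ(u) · (φ̃_Γ(a)^{-1} τ(ρ(a)(u)) φ̃_Γ(a))^{-1} for all a ∈ Γ, u ∈ G. Then the map φ̃'_T : G → E defined by φ̃'_T(u) := φ̃_T(u) · τ(u) is a group homomorphism satisfying q ∘ φ̃'_T = φ_T and φ̃'_T(ρ(a)(u)) φ̃_Γ(a) = φ̃_Γ(a) φ̃'_T(u) for all u ∈ G, a ∈ Γ. -/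
section LiftingObstruction

variable {H E G Γ : Type*} [Group H] [Group E] [Group G] [Group Γ]

/-- Suppose `τ : G → A = ker q` satisfies
(i) `τ(u₁u₂) = τ(u₂) * (φ̃_T(u₂)⁻¹ τ(u₁) φ̃_T(u₂))` and
(ii) `σ(a)(u) = τ(u) * (φ̃_Γ(a)⁻¹ τ(ρ(a)(u)) φ̃_Γ(a))⁻¹`.
Then `φ̃'_T(u) := φ̃_T(u) τ(u)` is a group homomorphism satisfying
`q ∘ φ̃'_T = φ_T` and `φ̃'_T(ρ(a)(u)) φ̃_Γ(a) = φ̃_Γ(a) φ̃'_T(u)`. -/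
theorem twisted_lift_is_equivariant_hom (q : E →* H)
    (hA : ∀ x ∈ q.ker, ∀ y ∈ q.ker, x * y = y * x)
    (ρ : Γ →* MulAut G) (φT : G →* H) (φΓ : Γ →* H)
    (hcompat : ∀ u a, φT (ρ a u) * φΓ a = φΓ a * φT u)
    (φtT : G →* E) (φtΓ : Γ →* E)
    (hqT : ∀ u, q (φtT u) = φT u) (hqΓ : ∀ a, q (φtΓ a) = φΓ a)
    (τ : G → E) (hτ : ∀ u, τ u ∈ q.ker)
    (hcocycle : ∀ u₁ u₂ : G, τ (u₁ * u₂) = τ u₂ * ((φtT u₂)⁻¹ * τ u₁ * φtT u₂))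
    (hcobound : ∀ (a : Γ) (u : G),
      liftingCocycle ρ φtT φtΓ a u = τ u * ((φtΓ a)⁻¹ * τ (ρ a u) * φtΓ a)⁻¹) :
    (∀ u₁ u₂ : G, φtT (u₁ * u₂) * τ (u₁ * u₂) = (φtT u₁ * τ u₁) * (φtT u₂ * τ u₂)) ∧
    (φtT (1 : G) * τ 1 = 1) ∧
    (∀ u : G, q (φtT u * τ u) = φT u) ∧
    (∀ (u : G) (a : Γ),
      (φtT (ρ a u) * τ (ρ a u)) * φtΓ a = φtΓ a * (φtT u * τ u)) := by
  have hconj : ∀ u v, (φtT v)⁻¹ * τ u * φtT v ∈ q.ker := fun u v => by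
    simpa using q.normal_ker.conj_mem (τ u) (hτ u) (φtT v)⁻¹
  have hmul : ∀ u₁ u₂ : G,
      φtT (u₁ * u₂) * τ (u₁ * u₂) = (φtT u₁ * τ u₁) * (φtT u₂ * τ u₂) := fun u₁ u₂ => by
    rw [hcocycle, hA _ (hτ u₂) _ (hconj u₁ u₂), map_mul]
    group
  refine ⟨hmul, ?_, fun u => ?_, fun u a => ?_⟩
  · simpa using hmul 1 1
  · rw [map_mul, MonoidHom.mem_ker.mp (hτ u), mul_one, hqT]
  · have h := hcobound a u
    rw [eq_mul_inv_iff_mul_eq] at h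
    rw [← h, liftingCocycle]
    group

end LiftingObstruction
end
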